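/- arXiv:1208.3043 — 3 statements merged into one kernel-verified Lean document; each statement's English description precedes it below -/
import Mathlib

section
/- Let {Z_n} be a time-homogeneous irreducible Markov chain on a countable state space 𝒮 and let {Z̃_n} be the embedded Markov chain defined below; assume {Z̃_n} is irreducible. If there exist a real number ε > 0, a finite subset 𝒱 ⊂ 𝒮, and a real-valued function f on 𝒮 bounded from below such that E(f(Z̃_{n+1}) − f(Z̃_n) | Z̃_n = i) ≤ −ε for every i ∈ 𝒮 ∖ 𝒱 and E(f(Z̃_{n+1}) | Z̃_n = i) < ∞ for every i ∈ 𝒱, then the original Markov chain {Z_n} is positive recurrent. -/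
open scoped Classical ENNReal

section GeneralMarkov

variable {S : Type*}

/-- `P` is a stochastic transition matrix on the countable state space `S`. -/
def IsStochastic (P : S → S → ℝ) : Prop :=
  (∀ i j, 0 ≤ P i j) ∧ ∀ i, HasSum (P i) 1

/-- `n`-step transition probabilities of the time-homogeneous Markov chain
with one-step transition matrix `P`. -/
noncomputable def nstep (P : S → S → ℝ) : ℕ → S → S → ℝ
  | 0 => fun i j => if i = j then (1 : ℝ) else 0
  | n + 1 => fun i j => ∑' k, nstep P n i k * P k j

/-- Irreducibility: every state is reachable from every state with positive
probability. -/
def MCIrreducible (P : S → S → ℝ) : Prop := ∀ i j, ∃ n, 0 < nstep P n i j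

/-- `firstRet P n i j` is the probability that the chain started at `i` visits `j`
for the first time at time `n`. -/
noncomputable def firstRet (P : S → S → ℝ) : ℕ → S → S → ℝ
  | 0 => fun _ _ => 0
  | 1 => fun i j => P i j
  | n + 2 => fun i j => ∑' k, if k = j then 0 else P i k * firstRet P (n + 1) k j

/-- Probability of ever returning to `i`. -/
noncomputable def returnProb (P : S → S → ℝ) (i : S) : ℝ≥0∞ :=
  ∑' n : ℕ, ENNReal.ofReal (firstRet P n i i)

/-- Expected return time to `i`. -/
noncomputable def meanReturnTime (P : S → S → ℝ) (i : S) : ℝ≥0∞ :=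
  ∑' n : ℕ, (n : ℝ≥0∞) * ENNReal.ofReal (firstRet P n i i)

/-- A Markov chain is positive recurrent if the return probability is one and the
expected return time is finite (for every state). -/
def PositiveRecurrent (P : S → S → ℝ) : Prop :=
  ∀ i, returnProb P i = 1 ∧ meanReturnTime P i < ⊤

/-- A Markov chain is transient if the probability of ever returning to a state is
less than one. -/
def MCTransient (P : S → S → ℝ) : Prop := ∀ i, returnProb P i < 1

/-- `π` is a stationary distribution of the chain with transition matrix `P`. -/
def IsStatDist (P : S → S → ℝ) (π : S → ℝ) : Prop :=
  (∀ i, 0 ≤ π i) ∧ HasSum π 1 ∧ ∀ j, HasSum (fun i => π i * P i j) (π j)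

end GeneralMarkov

section Helpers

variable {S : Type*}

/-- Transition operator acting on nonnegative functions. -/
noncomputable def opF (p : S → S → ℝ≥0∞) (g : S → ℝ≥0∞) (i : S) : ℝ≥0∞ :=
  ∑' k, p i k * g k

/-- Transition operator killed on entering `j`. -/
noncomputable def opK (p : S → S → ℝ≥0∞) (j : S) (g : S → ℝ≥0∞) (i : S) : ℝ≥0∞ :=
  ∑' k, p i k * (if k = j then 0 else g k)

lemma opF_mono (p : S → S → ℝ≥0∞) : Monotone (opF p) := by
  intro g h hgh i
  exact ENNReal.tsum_le_tsum fun k => mul_le_mul_right (hgh k) _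

lemma opK_mono (p : S → S → ℝ≥0∞) (j : S) : Monotone (opK p j) := by
  intro g h hgh i
  refine ENNReal.tsum_le_tsum fun k => mul_le_mul_right ?_ _
  split_ifs
  · exact le_rfl
  · exact hgh k

lemma opK_le_opF (p : S → S → ℝ≥0∞) (j : S) (g : S → ℝ≥0∞) : opK p j g ≤ opF p g := by
  intro i
  refine ENNReal.tsum_le_tsum fun k => mul_le_mul_right ?_ _
  split_ifs
  · exact zero_le
  · exact le_rfl

lemma opK_add (p : S → S → ℝ≥0∞) (j : S) (g h : S → ℝ≥0∞) :
    opK p j (g + h) = opK p j g + opK p j h := by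
  funext i
  simp only [opK, Pi.add_apply]
  rw [← ENNReal.tsum_add]
  congr 1; funext k
  split_ifs <;> simp [mul_add]

lemma opK_smul (p : S → S → ℝ≥0∞) (j : S) (c : ℝ≥0∞) (g : S → ℝ≥0∞) :
    opK p j (fun k => c * g k) = fun i => c * opK p j g i := by
  funext i
  simp only [opK]
  rw [← ENNReal.tsum_mul_left]
  congr 1; funext k
  split_ifs
  · simp
  · ring

lemma opK_const_le (p : S → S → ℝ≥0∞) (hp : ∀ i, ∑' k, p i k = 1) (j : S) (c : ℝ≥0∞) (i : S) :
    opK p j (fun _ => c) i ≤ c := by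
  refine (opK_le_opF p j _ i).trans ?_
  simp [opF, ENNReal.tsum_mul_right, hp]

lemma opF_const (p : S → S → ℝ≥0∞) (hp : ∀ i, ∑' k, p i k = 1) (c : ℝ≥0∞) :
    opF p (fun _ => c) = fun _ => c := by
  funext i
  simp [opF, ENNReal.tsum_mul_right, hp]

lemma opF_iter_one (p : S → S → ℝ≥0∞) (hp : ∀ i, ∑' k, p i k = 1) (n : ℕ) :
    (opF p)^[n] (fun _ => 1) = fun _ => 1 :=
  Function.iterate_fixed (opF_const p hp 1) n

lemma ofReal_tsum_aux {a : S → ℝ} (ha : ∀ k, 0 ≤ a k)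
    (h : ∑' k, ENNReal.ofReal (a k) ≠ ⊤) :
    ENNReal.ofReal (∑' k, a k) = ∑' k, ENNReal.ofReal (a k) := by
  refine ENNReal.ofReal_tsum_of_nonneg ha ?_
  have := ENNReal.summable_toReal h
  simpa [ENNReal.toReal_ofReal, ha] using this

lemma stoch_sum {P : S → S → ℝ} (hP : IsStochastic P) (i : S) :
    ∑' k, ENNReal.ofReal (P i k) = 1 := by
  rw [← ENNReal.ofReal_tsum_of_nonneg (hP.1 i) (hP.2 i).summable, (hP.2 i).tsum_eq]
  simp

lemma stoch_le_one {P : S → S → ℝ} (hP : IsStochastic P) (i k : S) :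
    ENNReal.ofReal (P i k) ≤ 1 :=
  (ENNReal.le_tsum k).trans (stoch_sum hP i).le

lemma nstep_opF {P : S → S → ℝ} (hP : IsStochastic P) (n : ℕ) :
    (∀ i j, 0 ≤ nstep P n i j) ∧ ∀ (g : S → ℝ≥0∞) (i : S),
      ∑' j, ENNReal.ofReal (nstep P n i j) * g j
        = (opF fun i j => ENNReal.ofReal (P i j))^[n] g i := by
  induction n with
  | zero =>
    refine ⟨fun i j => by simp only [nstep]; split_ifs <;> norm_num, fun g i => ?_⟩
    simp only [nstep, Function.iterate_zero, id]
    rw [tsum_eq_single i]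
    · simp
    · intro b hb
      simp [Ne.symm hb]
  | succ n ih =>
    obtain ⟨h0, h1⟩ := ih
    refine ⟨fun i j => tsum_nonneg fun k => mul_nonneg (h0 i k) (hP.1 k j), fun g i => ?_⟩
    have key : ∀ j, ENNReal.ofReal (nstep P (n+1) i j)
        = ∑' k, ENNReal.ofReal (nstep P n i k) * ENNReal.ofReal (P k j) := by
      intro j
      simp only [nstep]
      rw [ofReal_tsum_aux (fun k => mul_nonneg (h0 i k) (hP.1 k j))]
      · congr 1; funext k; exact ENNReal.ofReal_mul (h0 i k)
      · have : ∑' k, ENNReal.ofReal (nstep P n i k * P k j) ≤ 1 := by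
          calc _ = ∑' k, ENNReal.ofReal (nstep P n i k) * ENNReal.ofReal (P k j) := by
                congr 1; funext k; exact ENNReal.ofReal_mul (h0 i k)
            _ ≤ ∑' k, ENNReal.ofReal (nstep P n i k) * (fun _ => 1) k :=
                ENNReal.tsum_le_tsum fun k => mul_le_mul_right (stoch_le_one hP k j) _
            _ = 1 := by rw [h1, opF_iter_one _ (stoch_sum hP)]
        exact ne_top_of_le_ne_top ENNReal.one_ne_top this
    rw [Function.iterate_succ_apply, ← h1]
    simp only [key, opF]
    simp_rw [← ENNReal.tsum_mul_right, ← ENNReal.tsum_mul_left]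
    rw [ENNReal.tsum_comm]
    simp_rw [mul_assoc]

/-- Survival probabilities plus visit probabilities are at most one. -/
lemma surv_add_le (p : S → S → ℝ≥0∞) (hp : ∀ i, ∑' k, p i k = 1) (j : S) (n : ℕ) :
    ∀ i, (i ≠ j ∨ n ≠ 0) → (opK p j)^[n] (fun _ => 1) i
      + (opF p)^[n] (fun k => if k = j then 1 else 0) i ≤ 1 := by
  induction n with
  | zero =>
    intro i hi
    have : i ≠ j := by simpa using hi
    simp [this]
  | succ n ih =>
    intro i _
    rw [Function.iterate_succ_apply', Function.iterate_succ_apply']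
    simp only [opK, opF]
    rw [← ENNReal.tsum_add]
    refine le_of_le_of_eq (ENNReal.tsum_le_tsum fun k => ?_) (hp i)
    rw [← mul_add]
    have hle : (opF p)^[n] (fun k => if k = j then 1 else 0) k ≤ 1 := by
      have h := (opF_mono p).iterate n
        (show (fun k => if k = j then (1:ℝ≥0∞) else 0) ≤ fun _ => 1 by
          intro k; dsimp only; split_ifs <;> simp) k
      rwa [opF_iter_one p hp] at h
    calc _ ≤ p i k * 1 := by
          gcongr
          split_ifs with h
          · simpa using hle
          · exact ih k (Or.inl h)
      _ = p i k := mul_one _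

lemma surv_lt_one (p : S → S → ℝ≥0∞) (hp : ∀ i, ∑' k, p i k = 1) (j : S)
    (hirr : ∀ i, ∃ n, 0 < (opF p)^[n] (fun k => if k = j then 1 else 0) i) (i : S) :
    ∃ n, (opK p j)^[n] (fun _ => 1) i < 1 := by
  have key : ∃ n, n ≠ 0 ∧ 0 < (opF p)^[n] (fun k => if k = j then 1 else 0) i := by
    obtain ⟨k, hk⟩ : ∃ k, p i k ≠ 0 := by
      by_contra! h
      have := hp i
      simp [h] at this
    obtain ⟨n, hn⟩ := hirr k
    refine ⟨n+1, by simp, ?_⟩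
    rw [Function.iterate_succ_apply']
    refine lt_of_lt_of_le ?_ (ENNReal.le_tsum k)
    exact ENNReal.mul_pos hk hn.ne'
  obtain ⟨n, h0, hn⟩ := key
  refine ⟨n, ?_⟩
  have h := surv_add_le p hp j n i (Or.inr h0)
  have hne : (opK p j)^[n] (fun _ => 1) i ≠ ⊤ :=
    ne_top_of_le_ne_top ENNReal.one_ne_top (le_self_add.trans h)
  exact lt_of_lt_of_le (ENNReal.lt_add_right hne hn.ne') h

/-- Expected cost accumulated in the first `N` steps before hitting `j`. -/
noncomputable def cost (p : S → S → ℝ≥0∞) (j : S) (c : S → ℝ≥0∞) : ℕ → S → ℝ≥0∞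
  | 0 => fun _ => 0
  | N + 1 => fun i => c i + opK p j (cost p j c N) i

lemma cost_mono_succ (p : S → S → ℝ≥0∞) (j : S) (c : S → ℝ≥0∞) (N : ℕ) :
    cost p j c N ≤ cost p j c (N+1) := by
  induction N with
  | zero => intro i; simp [cost]
  | succ N ih =>
    intro i
    exact add_le_add_right (opK_mono p j ih i) _

lemma cost_le_super (p : S → S → ℝ≥0∞) (j : S) (c W : S → ℝ≥0∞)
    (h : ∀ i, c i + opK p j W i ≤ W i) (N : ℕ) : cost p j c N ≤ W := by
  induction N with
  | zero => intro i; simp [cost]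
  | succ N ih =>
    intro i
    exact (add_le_add_right (opK_mono p j ih i) _).trans (h i)

lemma cost_ne_top (p : S → S → ℝ≥0∞) (hp : ∀ i, ∑' k, p i k = 1) (j : S) (c : S → ℝ≥0∞)
    (hc : ∀ i, c i ≤ 1) (N : ℕ) (i : S) : cost p j c N i ≤ N := by
  induction N generalizing i with
  | zero => simp [cost]
  | succ N ih =>
    have h1 : opK p j (cost p j c N) i ≤ N :=
      (opK_mono p j (show cost p j c N ≤ fun _ => (N:ℝ≥0∞) from ih) i).trans
        (opK_const_le p hp j _ i)
    simp only [cost]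
    push_cast
    rw [add_comm]
    exact add_le_add h1 (hc i)

lemma cost_iter (p : S → S → ℝ≥0∞) (hp : ∀ i, ∑' k, p i k = 1) (j : S) (c : S → ℝ≥0∞)
    (hc : ∀ i, c i ≤ 1) (N t : ℕ) (i : S) :
    cost p j c N i ≤ t + (opK p j)^[t] (cost p j c N) i := by
  induction t generalizing i with
  | zero => simp
  | succ t ih =>
    have h1 : cost p j c N i ≤ 1 + opK p j (cost p j c N) i :=
      (cost_mono_succ p j c N i).trans (add_le_add_left (hc i) _)
    have h2 : opK p j (cost p j c N) i
        ≤ opK p j ((fun _ => (t:ℝ≥0∞)) + (opK p j)^[t] (cost p j c N)) i :=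
      opK_mono p j (fun k => ih k) i
    rw [opK_add] at h2
    rw [Function.iterate_succ_apply']
    push_cast
    calc _ ≤ _ := h1
      _ ≤ 1 + ((t:ℝ≥0∞) + opK p j ((opK p j)^[t] (cost p j c N)) i) := by
          refine add_le_add_right (h2.trans ?_) _
          exact add_le_add_left (opK_const_le p hp j _ i) _
      _ = _ := by ring

lemma opK_iter_smul (p : S → S → ℝ≥0∞) (j : S) (c : ℝ≥0∞) (t : ℕ) (i : S) :
    (opK p j)^[t] (fun _ => c) i = c * (opK p j)^[t] (fun _ => 1) i := by
  induction t generalizing i with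
  | zero => simp
  | succ t ih =>
    rw [Function.iterate_succ_apply', Function.iterate_succ_apply']
    have : (opK p j)^[t] (fun _ => c) = fun i => c * (opK p j)^[t] (fun _ => 1) i := funext ih
    rw [this, opK_smul]

/-- Expected number of visits to a finite set before hitting `j` is finite. -/
lemma visits_bdd (p : S → S → ℝ≥0∞) (hp : ∀ i, ∑' k, p i k = 1) (j : S)
    (hirr : ∀ i, ∃ n, 0 < (opF p)^[n] (fun k => if k = j then 1 else 0) i) (V : Finset S) :
    ∃ B : ℝ≥0∞, B ≠ ⊤ ∧ ∀ N i, cost p j (fun i => if i ∈ V then 1 else 0) N i ≤ B := by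
  choose d hd using surv_lt_one p hp j hirr
  set c : S → ℝ≥0∞ := fun i => if i ∈ V then 1 else 0 with hcdef
  have hc : ∀ i, c i ≤ 1 := by intro i; simp only [hcdef]; split_ifs <;> simp
  set b : S → ℝ≥0∞ := fun v => (d v : ℝ≥0∞) / (1 - (opK p j)^[d v] (fun _ => 1) v) with hb
  have hbt : ∀ v, b v ≠ ⊤ := fun v =>
    ENNReal.div_ne_top (ENNReal.natCast_ne_top _) (tsub_pos_of_lt (hd v)).ne'
  have hext : ∀ (A : ℝ≥0∞) (N : ℕ), (∀ v ∈ V, cost p j c N v ≤ A) → ∀ i, cost p j c N i ≤ A := by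
    intro A N
    induction N with
    | zero => intro _ i; simp [cost]
    | succ N ih =>
      intro h i
      by_cases hi : i ∈ V
      · exact h i hi
      · have h2 := ih fun v hv => (cost_mono_succ p j c N v).trans (h v hv)
        have h3 : opK p j (cost p j c N) i ≤ A :=
          (opK_mono p j (show cost p j c N ≤ fun _ => A from h2) i).trans
            (opK_const_le p hp j _ i)
        simpa [cost, hcdef, hi] using h3
  refine ⟨∑ v ∈ V, b v, (ENNReal.sum_ne_top.2 fun v _ => hbt v), fun N => hext _ N ?_⟩
  intro v hv
  obtain ⟨w, hw, hmax⟩ := V.exists_max_image (cost p j c N) ⟨v, hv⟩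
  set A := cost p j c N w with hA
  have hAt : A ≠ ⊤ := ne_top_of_le_ne_top (ENNReal.natCast_ne_top N) (cost_ne_top p hp j c hc N w)
  have hall := hext A N hmax
  have h1 : A ≤ d w + A * (opK p j)^[d w] (fun _ => 1) w := by
    rw [← opK_iter_smul]
    refine (cost_iter p hp j c hc N (d w) w).trans (add_le_add_right ?_ _)
    exact (opK_mono p j).iterate (d w) (show cost p j c N ≤ fun _ => A from hall) w
  have h2 : A ≤ b w := by
    rw [hb]
    simp only
    rw [ENNReal.le_div_iff_mul_le (Or.inl (tsub_pos_of_lt (hd w)).ne')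
      (Or.inl (ne_top_of_le_ne_top ENNReal.one_ne_top tsub_le_self)),
      ENNReal.mul_sub (fun _ _ => hAt), mul_one]
    exact tsub_le_iff_right.2 h1
  exact (hmax v hv).trans (h2.trans (Finset.single_le_sum (f := b) (fun _ _ => zero_le) hw))

/-- Abstract Foster criterion with cost `c`. -/
lemma foster_abstract (p : S → S → ℝ≥0∞) (hp : ∀ i, ∑' k, p i k = 1) (j : S)
    (hirr : ∀ i, ∃ n, 0 < (opF p)^[n] (fun k => if k = j then 1 else 0) i) (V : Finset S)
    (c F : S → ℝ≥0∞) (hF : F j ≠ ⊤) (hc : ∀ i, c i ≠ ⊤)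
    (hV : ∀ i ∈ V, opF p F i ≠ ⊤) (hd : ∀ i ∉ V, c i + opF p F i ≤ F i) :
    ∃ B : ℝ≥0∞, B ≠ ⊤ ∧ ∀ N, cost p j c N j ≤ B := by
  obtain ⟨B, hB, hBN⟩ := visits_bdd p hp j hirr V
  set e : S → ℝ≥0∞ := fun i => if i ∈ V then 1 else 0 with he
  set C : ℝ≥0∞ := ∑ v ∈ V, (c v + opF p F v) with hC
  have hCt : C ≠ ⊤ := ENNReal.sum_ne_top.2 fun v hv => ENNReal.add_ne_top.2 ⟨hc v, hV v hv⟩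
  have hstep : ∀ i, c i + opF p F i ≤ F i + C * e i := by
    intro i
    by_cases hi : i ∈ V
    · simp only [he, hi, if_true, mul_one]
      exact (Finset.single_le_sum (f := fun v => c v + opF p F v) (fun _ _ => zero_le) hi).trans
        le_add_self
    · simpa [he, hi] using hd i hi
  have key : ∀ N i, cost p j c N i ≤ F i + C * cost p j e N i := by
    intro N
    induction N with
    | zero => intro i; simp [cost]
    | succ N ih =>
      intro i
      have h1 : opK p j (cost p j c N) i ≤ opK p j (F + fun k => C * cost p j e N k) i :=
        opK_mono p j (fun k => ih k) i
      rw [opK_add, opK_smul] at h1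
      simp only [cost]
      calc _ ≤ c i + (opF p F i + C * opK p j (cost p j e N) i) :=
            add_le_add_right (h1.trans (add_le_add_left (opK_le_opF p j F i) _)) _
        _ = (c i + opF p F i) + C * opK p j (cost p j e N) i := by ring
        _ ≤ (F i + C * e i) + C * opK p j (cost p j e N) i := add_le_add_left (hstep i) _
        _ = _ := by ring
  refine ⟨F j + C * B, ENNReal.add_ne_top.2 ⟨hF, ENNReal.mul_ne_top hCt hB⟩, fun N => ?_⟩
  exact (key N j).trans (add_le_add_right (mul_le_mul_right (hBN N j) _) _)

lemma cost_time (p : S → S → ℝ≥0∞) (hp : ∀ i, ∑' k, p i k = 1) (j : S) (N t : ℕ) (i : S) :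
    cost p j (fun _ => 1) (N+1) i ≤ ((t+1 : ℕ) : ℝ≥0∞)
      + (opF p)^[t+1] (fun k => if k = j then 0 else cost p j (fun _ => 1) N k) i := by
  induction t generalizing i with
  | zero => simp [cost, opF, opK]
  | succ t ih =>
    set g : S → ℝ≥0∞ := fun k => if k = j then 0 else cost p j (fun _ => 1) N k
    have h1 : cost p j (fun _ => 1) (N+1) i ≤ 1 + opF p (cost p j (fun _ => 1) (N+1)) i := by
      simp only [cost]
      exact add_le_add_right ((opK_le_opF p j _ i).trans
        (opF_mono p (cost_mono_succ p j (fun _ => 1) N) i)) _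
    have h2 := opF_mono p (show cost p j (fun _ => 1) (N+1) ≤
      fun k => ((t+1 : ℕ) : ℝ≥0∞) + (opF p)^[t+1] g k from ih) i
    have h3 : opF p (fun k => ((t+1 : ℕ) : ℝ≥0∞) + (opF p)^[t+1] g k) i
        = ((t+1 : ℕ) : ℝ≥0∞) + opF p ((opF p)^[t+1] g) i := by
      simp only [opF, mul_add]
      rw [ENNReal.tsum_add, ENNReal.tsum_mul_right, hp, one_mul]
    rw [h3] at h2
    rw [Function.iterate_succ_apply']
    calc _ ≤ _ := h1.trans (add_le_add_right h2 _)
      _ = _ := by push_cast; ring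

lemma cost_embed (p q : S → S → ℝ≥0∞) (hp : ∀ i, ∑' k, p i k = 1) (j : S) (τ : S → ℕ)
    (hτ : ∀ i, 0 < τ i) (hq : ∀ g i, opF q g i = (opF p)^[τ i] g i) (N : ℕ) (i : S) :
    cost p j (fun _ => 1) N i ≤ cost q j (fun i => (τ i : ℝ≥0∞)) N i := by
  induction N generalizing i with
  | zero => simp [cost]
  | succ N ih =>
    obtain ⟨t, ht⟩ := Nat.exists_eq_succ_of_ne_zero (hτ i).ne'
    refine (cost_time p hp j N t i).trans ?_
    have h := hq (fun k => if k = j then 0 else cost p j (fun _ => 1) N k) i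
    rw [ht] at h
    rw [← Nat.succ_eq_add_one, ← h]
    conv_rhs => rw [cost]
    rw [← ht]
    exact add_le_add_right (opK_mono q j (show cost p j (fun _ => 1) N ≤ _ from ih) i) _

lemma cost_eq_sum (p : S → S → ℝ≥0∞) (j : S) (N : ℕ) (i : S) :
    cost p j (fun _ => 1) N i = ∑ n ∈ Finset.range N, (opK p j)^[n] (fun _ => 1) i := by
  have h : ∀ N, cost p j (fun _ => 1) N + (opK p j)^[N] (fun _ => 1)
      = cost p j (fun _ => 1) (N+1) := by
    intro N
    induction N with
    | zero => funext i; simp [cost, opK]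
    | succ N ih =>
      funext i
      conv_rhs => rw [cost, ← ih, opK_add]
      rw [Function.iterate_succ_apply']
      simp [cost, add_assoc]
  induction N with
  | zero => simp [cost]
  | succ N ih =>
    rw [Finset.sum_range_succ, ← ih, ← h]
    rfl

lemma firstRet_surv {P : S → S → ℝ} (hP : IsStochastic P) (j : S) (n : ℕ) :
    ∀ i, 0 ≤ firstRet P (n+1) i j ∧ ENNReal.ofReal (firstRet P (n+1) i j)
      + (opK (fun i j => ENNReal.ofReal (P i j)) j)^[n+1] (fun _ => 1) i
      = (opK (fun i j => ENNReal.ofReal (P i j)) j)^[n] (fun _ => 1) i := by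
  set p : S → S → ℝ≥0∞ := fun i j => ENNReal.ofReal (P i j) with hpdef
  have hp : ∀ i, ∑' k, p i k = 1 := stoch_sum hP
  have hs : ∀ n i, (opK p j)^[n] (fun _ => 1) i ≤ 1 := by
    intro n
    induction n with
    | zero => intro i; simp
    | succ n ih =>
      intro i
      rw [Function.iterate_succ_apply']
      exact (opK_mono p j (show _ ≤ fun _ => (1:ℝ≥0∞) from ih) i).trans (opK_const_le p hp j _ i)
  induction n with
  | zero =>
    intro i
    refine ⟨hP.1 i j, ?_⟩
    simp only [firstRet, zero_add, Function.iterate_one, Function.iterate_zero, id, opK]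
    have h : ENNReal.ofReal (P i j) = ∑' k, p i k * (if k = j then 1 else 0) := by
      rw [tsum_eq_single j]
      · simp [hpdef]
      · intro b hb; simp [hb]
    rw [h, ← ENNReal.tsum_add]
    refine Eq.trans ?_ (hp i)
    congr 1; funext k
    split_ifs <;> simp
  | succ n ih =>
    intro i
    have hnn : ∀ k, 0 ≤ (if k = j then 0 else P i k * firstRet P (n+1) k j) := by
      intro k
      split_ifs
      · exact le_rfl
      · exact mul_nonneg (hP.1 i k) (ih k).1
    have heq : ∑' k, ENNReal.ofReal (if k = j then 0 else P i k * firstRet P (n+1) k j)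
        = opK p j (fun k => ENNReal.ofReal (firstRet P (n+1) k j)) i := by
      simp only [opK]
      congr 1; funext k
      split_ifs
      · simp
      · rw [ENNReal.ofReal_mul (hP.1 i k)]
    have hle : opK p j (fun k => ENNReal.ofReal (firstRet P (n+1) k j)) i ≤ 1 := by
      refine (opK_mono p j (show _ ≤ fun _ => (1:ℝ≥0∞) from fun k => ?_) i).trans
        (opK_const_le p hp j _ i)
      have := (ih k).2
      exact (le_self_add.trans this.le).trans (hs n k)
    refine ⟨tsum_nonneg hnn, ?_⟩
    have h1 : ENNReal.ofReal (firstRet P (n+1+1) i j)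
        = opK p j (fun k => ENNReal.ofReal (firstRet P (n+1) k j)) i := by
      rw [← heq]
      exact ofReal_tsum_aux hnn (heq ▸ ne_top_of_le_ne_top ENNReal.one_ne_top hle)
    rw [h1, Function.iterate_succ_apply' _ (n+1), Function.iterate_succ_apply' _ n,
      ← Pi.add_apply, ← opK_add]
    congr 1
    funext k
    have := (ih k).2
    rw [Function.iterate_succ_apply'] at this
    simpa [Function.iterate_succ_apply'] using this

lemma posrec_of_bdd {P : S → S → ℝ} (hP : IsStochastic P) (j : S) (B : ℝ≥0∞) (hB : B ≠ ⊤)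
    (h : ∀ N, cost (fun i j => ENNReal.ofReal (P i j)) j (fun _ => 1) N j ≤ B) :
    returnProb P j = 1 ∧ meanReturnTime P j < ⊤ := by
  set p : S → S → ℝ≥0∞ := fun i j => ENNReal.ofReal (P i j) with hpdef
  set s : ℕ → ℝ≥0∞ := fun n => (opK p j)^[n] (fun _ => 1) j with hs
  set r : ℕ → ℝ≥0∞ := fun n => ENNReal.ofReal (firstRet P n j j) with hr
  have hr0 : r 0 = 0 := by simp [hr, firstRet]
  have hrs : ∀ n, r (n+1) + s (n+1) = s n := fun n => (firstRet_surv hP j n j).2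
  have hsum : ∀ N, ∑ n ∈ Finset.range N, s n ≤ B := fun N => by
    rw [← cost_eq_sum]; exact h N
  have hts : ∑' n, s n ≠ ⊤ := by
    refine ne_top_of_le_ne_top hB ?_
    rw [ENNReal.tsum_eq_iSup_nat]
    exact iSup_le hsum
  have hs0 : Filter.Tendsto s Filter.atTop (nhds 0) :=
    ENNReal.tendsto_atTop_zero_of_tsum_ne_top hts
  have hp1 : ∀ N, ∑ n ∈ Finset.range (N+1), r n + s N = 1 := by
    intro N
    induction N with
    | zero => simp [hr0, hs]
    | succ N ih => rw [Finset.sum_range_succ, add_assoc, hrs, ih]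
  have hm : ∀ N, ∑ n ∈ Finset.range (N+1), (n:ℝ≥0∞) * r n + N * s N
      = ∑ n ∈ Finset.range N, s n := by
    intro N
    induction N with
    | zero => simp
    | succ N ih =>
      rw [Finset.sum_range_succ, Finset.sum_range_succ s N, ← ih, add_assoc, ← mul_add, hrs]
      push_cast; ring
  constructor
  · have h1 : Filter.Tendsto (fun N => ∑ n ∈ Finset.range (N+1), r n + s N) Filter.atTop
        (nhds (∑' n, r n + 0)) :=
      ((ENNReal.tendsto_nat_tsum r).comp (Filter.tendsto_add_atTop_nat 1)).add hs0
    simp only [hp1, add_zero] at h1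
    exact (tendsto_nhds_unique h1 tendsto_const_nhds)
  · refine lt_of_le_of_lt ?_ hB.lt_top
    change ∑' n : ℕ, (n:ℝ≥0∞) * r n ≤ B
    rw [ENNReal.tsum_eq_iSup_nat]
    refine iSup_le fun N => ?_
    refine (Finset.sum_le_sum_of_subset (Finset.range_subset_range.2 (Nat.le_succ N))).trans ?_
    exact (le_self_add.trans (hm N).le).trans (hsum N)

end Helpers

/-- **Foster's criterion via an embedded chain.** Let `{Z_n}` be a time-homogeneous
irreducible Markov chain on a countable state space `S`, partitioned into finitely many
nonempty classes (`part` surjective onto `Fin m`) with a positive integer `T k` attached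
to each class, and let `{Z̃_n}` be the embedded chain obtained by observing `{Z_n}` at the
times `t_0 = 0`, `t_{n+1} = t_n + τ(Z_{t_n})` where `τ(i) = T (part i)`; its transition
matrix is `Q i j = nstep P (T (part i)) i j`. Assume `{Z̃_n}` is irreducible. If there
exist `ε > 0`, a finite `V ⊆ S` and `f : S → ℝ` bounded from below with
`E(f(Z̃_{n+1}) − f(Z̃_n) | Z̃_n = i) ≤ −ε` for `i ∉ V` and `E(f(Z̃_{n+1}) | Z̃_n = i) < ∞`
for `i ∈ V`, then `{Z_n}` is positive recurrent. -/
theorem foster_embedded {S : Type*} [Countable S] (P : S → S → ℝ)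
    (hP : IsStochastic P) (hirr : MCIrreducible P)
    (m : ℕ) (part : S → Fin m) (hpart : Function.Surjective part)
    (T : Fin m → ℕ) (hT : ∀ k, 0 < T k)
    (Q : S → S → ℝ) (hQ : Q = fun i j => nstep P (T (part i)) i j)
    (hQirr : MCIrreducible Q)
    (ε : ℝ) (hε : 0 < ε) (V : Finset S) (f : S → ℝ) (hf : BddBelow (Set.range f))
    (hdrift : ∀ i ∉ V, Summable (fun j => Q i j * (f j - f i)) ∧
      ∑' j, Q i j * (f j - f i) ≤ -ε)
    (hfin : ∀ i ∈ V, Summable fun j => Q i j * f j) :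
    PositiveRecurrent P := by
  intro j
  set p : S → S → ℝ≥0∞ := fun i j => ENNReal.ofReal (P i j) with hpdef
  set q : S → S → ℝ≥0∞ := fun i j => ENNReal.ofReal (Q i j) with hqdef
  have hp : ∀ i, ∑' k, p i k = 1 := stoch_sum hP
  have hqF : ∀ g i, opF q g i = (opF p)^[T (part i)] g i := by
    intro g i
    simp only [opF, hqdef, hQ]
    exact (nstep_opF hP (T (part i))).2 g i
  have hQ0 : ∀ i k, 0 ≤ Q i k := by
    intro i k
    rw [hQ]
    exact (nstep_opF hP (T (part i))).1 i k
  have hq1 : ∀ i, ∑' k, q i k = 1 := by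
    intro i
    have h := hqF (fun _ => 1) i
    rw [opF_iter_one p hp] at h
    simpa [opF] using h
  have hQsum : ∀ i, Summable (Q i) := by
    intro i
    have h := ENNReal.summable_toReal (show ∑' k, q i k ≠ ⊤ by rw [hq1]; simp)
    simpa [hqdef, ENNReal.toReal_ofReal, hQ0] using h
  have hQtsum : ∀ i, ∑' k, Q i k = 1 := by
    intro i
    have h := ENNReal.ofReal_tsum_of_nonneg (hQ0 i) (hQsum i)
    rw [show ∑' k, ENNReal.ofReal (Q i k) = 1 from hq1 i] at h
    exact ENNReal.ofReal_eq_one.1 h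
  have hQst : IsStochastic Q := ⟨hQ0, fun i => hQtsum i ▸ (hQsum i).hasSum⟩
  have hirr' : ∀ i, ∃ n, 0 < (opF q)^[n] (fun k => if k = j then 1 else 0) i := by
    intro i
    obtain ⟨n, hn⟩ := hQirr i j
    refine ⟨n, ?_⟩
    rw [← (nstep_opF hQst n).2]
    refine lt_of_lt_of_le ?_ (ENNReal.le_tsum j)
    simpa using hn
  obtain ⟨L, hL⟩ := hf
  have hL' : ∀ k, 0 ≤ f k - L := fun k => sub_nonneg.2 (hL ⟨k, rfl⟩)
  set M : ℝ := ∑ k, (T k : ℝ) with hM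
  have hM0 : 0 ≤ M := Finset.sum_nonneg fun k _ => Nat.cast_nonneg _
  have hTM : ∀ k, (T k : ℝ) ≤ M := fun k =>
    Finset.single_le_sum (f := fun k => (T k : ℝ)) (fun _ _ => Nat.cast_nonneg _)
      (Finset.mem_univ k)
  set F : S → ℝ≥0∞ := fun k => ENNReal.ofReal (M / ε * (f k - L)) with hF
  have hMe : 0 ≤ M / ε := div_nonneg hM0 hε.le
  have hFeq : ∀ i, Summable (fun k => Q i k * (f k - L)) →
      opF q F i = ENNReal.ofReal (M / ε * ∑' k, Q i k * (f k - L)) := by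
    intro i hsum
    rw [← tsum_mul_left, ENNReal.ofReal_tsum_of_nonneg _ (hsum.mul_left _)]
    · simp only [opF, hqdef, hF]
      congr 1; funext k
      rw [← ENNReal.ofReal_mul (hQ0 i k)]
      congr 1; ring
    · intro k
      exact mul_nonneg hMe (mul_nonneg (hQ0 i k) (hL' k))
  obtain ⟨B, hB, hBN⟩ := foster_abstract q hq1 j hirr' V (fun i => (T (part i) : ℝ≥0∞)) F
    ENNReal.ofReal_ne_top (fun i => ENNReal.natCast_ne_top _)
    (by
      intro i hi
      have hs : Summable (fun k => Q i k * (f k - L)) := by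
        have := (hfin i hi).sub ((hQsum i).mul_right L)
        simpa [mul_sub] using this
      rw [hFeq i hs]
      exact ENNReal.ofReal_ne_top)
    (by
      intro i hi
      obtain ⟨h1, h2⟩ := hdrift i hi
      have heq : (fun k => Q i k * (f k - L))
          = fun k => Q i k * (f k - f i) + Q i k * (f i - L) := by
        funext k; ring
      have hs2 : Summable (fun k => Q i k * (f i - L)) := (hQsum i).mul_right _
      have hs : Summable (fun k => Q i k * (f k - L)) := by
        rw [heq]; exact h1.add hs2
      have hval : ∑' k, Q i k * (f k - L) ≤ -ε + (f i - L) := by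
        rw [heq, h1.tsum_add hs2, tsum_mul_right, hQtsum, one_mul]
        linarith
      rw [hFeq i hs, ← ENNReal.ofReal_natCast, ← ENNReal.ofReal_add (Nat.cast_nonneg _)
        (mul_nonneg hMe (tsum_nonneg fun k => mul_nonneg (hQ0 i k) (hL' k)))]
      refine ENNReal.ofReal_le_ofReal ?_
      have h3 := mul_le_mul_of_nonneg_left hval hMe
      have h4 : M / ε * (-ε + (f i - L)) = -M + M / ε * (f i - L) := by
        field_simp
      have h5 := hTM (part i)
      linarith)
  exact posrec_of_bdd hP j B hB fun N =>
    (cost_embed p q hp j (fun i => T (part i)) (fun i => hT _) hqF N j).trans (hBN N)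
end

section
/- Let {Z_n} be a time-homogeneous irreducible Markov chain on a countable state space 𝒮 and let {Z̃_n} be the embedded Markov chain defined below; assume {Z̃_n} is irreducible. If there exist a real-valued function f on 𝒮 and positive real numbers ε, c, b such that, setting 𝒜 = {i ∈ 𝒮 : f(i) > c}: (i) 𝒜 ≠ ∅ and its complement 𝒜^C ≠ ∅; (ii) E(f(Z̃_{n+1}) − f(Z̃_n) | Z̃_n = i) ≥ ε for every i ∈ 𝒜; and (iii) |f(j) − f(i)| > b implies P(Z_1 = j | Z_0 = i) = 0, then the Markov chain {Z_n} is transient. -/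
open scoped Classical ENNReal

namespace TransAux

open Finset

variable {S : Type*}

/-- One-step probabilities in `ℝ≥0∞`. -/
noncomputable def pe (P : S → S → ℝ) (i j : S) : ℝ≥0∞ := ENNReal.ofReal (P i j)

/-- `n`-step probabilities in `ℝ≥0∞`. -/
noncomputable def en (P : S → S → ℝ) : ℕ → S → S → ℝ≥0∞
  | 0 => fun i j => if i = j then 1 else 0
  | n + 1 => fun i j => ∑' k, en P n i k * pe P k j

/-- First hitting probabilities of `s` at time `n ≥ 0`. -/
noncomputable def g (P : S → S → ℝ) (s : S) : ℕ → S → ℝ≥0∞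
  | 0 => fun k => if k = s then 1 else 0
  | n + 1 => fun k => if k = s then 0 else ∑' l, pe P k l * g P s n l

/-- Probability of hitting `s` by time `N`. -/
noncomputable def u (P : S → S → ℝ) (s : S) (N : ℕ) (k : S) : ℝ≥0∞ :=
  ∑ n ∈ range (N + 1), g P s n k

lemma pe_sum {P : S → S → ℝ} (hP : IsStochastic P) (i : S) : ∑' j, pe P i j = 1 := by
  unfold pe
  rw [← ENNReal.ofReal_tsum_of_nonneg (hP.1 i) (hP.2 i).summable, (hP.2 i).tsum_eq]
  simp

lemma en_sum {P : S → S → ℝ} (hP : IsStochastic P) (n : ℕ) (i : S) : ∑' j, en P n i j = 1 := by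
  induction n with
  | zero => simp [en]
  | succ n ih =>
    simp only [en]
    rw [ENNReal.tsum_comm]
    simp_rw [ENNReal.tsum_mul_left, pe_sum hP, mul_one]
    exact ih

lemma en_ne_top {P : S → S → ℝ} (hP : IsStochastic P) (n : ℕ) (i j : S) : en P n i j ≠ ⊤ := by
  have h := ENNReal.le_tsum (f := fun j => en P n i j) j
  rw [en_sum hP] at h
  exact ne_top_of_le_ne_top ENNReal.one_ne_top h

lemma nstep_eq {P : S → S → ℝ} (hP : IsStochastic P) (n : ℕ) (i j : S) :
    nstep P n i j = (en P n i j).toReal := by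
  induction n generalizing j with
  | zero => simp only [nstep, en]; split_ifs <;> simp
  | succ n ih =>
    simp only [nstep, en]
    rw [ENNReal.tsum_toReal_eq]
    · refine tsum_congr fun k => ?_
      rw [ih, ENNReal.toReal_mul, pe, ENNReal.toReal_ofReal (hP.1 _ _)]
    · intro k
      exact ENNReal.mul_ne_top (en_ne_top hP _ _ _) ENNReal.ofReal_ne_top

lemma g_le_one {P : S → S → ℝ} (hP : IsStochastic P) (s : S) (n : ℕ) (k : S) : g P s n k ≤ 1 := by
  induction n generalizing k with
  | zero => simp only [g]; split_ifs <;> simp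
  | succ n ih =>
    simp only [g]
    split_ifs
    · simp
    · calc _ ≤ ∑' l, pe P k l := ENNReal.tsum_le_tsum fun l => mul_le_of_le_one_right' (ih l)
        _ = 1 := pe_sum hP k

lemma pg_le_one {P : S → S → ℝ} (hP : IsStochastic P) (s : S) (n : ℕ) (i : S) :
    ∑' k, pe P i k * g P s n k ≤ 1 :=
  calc _ ≤ ∑' l, pe P i l :=
        ENNReal.tsum_le_tsum fun l => mul_le_of_le_one_right' (g_le_one hP s n l)
    _ = 1 := pe_sum hP i

lemma firstRet_eq {P : S → S → ℝ} (hP : IsStochastic P) (s : S) (n : ℕ) (i : S) :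
    firstRet P (n + 1) i s = (∑' k, pe P i k * g P s n k).toReal := by
  induction n generalizing i with
  | zero =>
    simp only [firstRet, g, mul_ite, mul_one, mul_zero, tsum_ite_eq]
    rw [pe, ENNReal.toReal_ofReal (hP.1 _ _)]
  | succ n ih =>
    simp only [firstRet]
    rw [ENNReal.tsum_toReal_eq]
    · refine tsum_congr fun k => ?_
      simp only [g]
      split_ifs
      · simp
      · rw [ih, ENNReal.toReal_mul, pe, ENNReal.toReal_ofReal (hP.1 _ _)]
    · intro k
      exact ENNReal.mul_ne_top ENNReal.ofReal_ne_top
        (ne_top_of_le_ne_top ENNReal.one_ne_top (g_le_one hP s _ k))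

lemma returnProb_eq {P : S → S → ℝ} (hP : IsStochastic P) (s : S) :
    returnProb P s = ∑' k, pe P s k * ∑' n, g P s n k := by
  unfold returnProb
  rw [tsum_eq_zero_add' ENNReal.summable]
  simp_rw [firstRet_eq hP]
  simp_rw [← ENNReal.tsum_mul_left]
  rw [ENNReal.tsum_comm]
  simp only [firstRet, ENNReal.ofReal_zero, zero_add]
  refine tsum_congr fun n => ?_
  rw [ENNReal.ofReal_toReal (ne_top_of_le_ne_top ENNReal.one_ne_top (pg_le_one hP s n s))]

lemma u_self (P : S → S → ℝ) (s : S) (N : ℕ) : u P s N s = 1 := by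
  unfold u
  rw [sum_range_succ']
  simp [g]

lemma u_succ (P : S → S → ℝ) (s : S) (N : ℕ) {k : S} (hk : k ≠ s) :
    u P s (N + 1) k = ∑' l, pe P k l * u P s N l := by
  unfold u
  rw [sum_range_succ']
  simp only [g, hk, if_false, add_zero, mul_sum]
  rw [Summable.tsum_finsetSum (fun _ _ => ENNReal.summable)]

lemma u_mono (P : S → S → ℝ) (s : S) {N M : ℕ} (h : N ≤ M) (k : S) : u P s N k ≤ u P s M k :=
  sum_le_sum_of_subset (range_mono (by omega))

lemma u_le_one {P : S → S → ℝ} (hP : IsStochastic P) (s : S) (N : ℕ) (k : S) :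
    u P s N k ≤ 1 := by
  induction N generalizing k with
  | zero => simpa [u] using g_le_one hP s 0 k
  | succ N ih =>
    by_cases hk : k = s
    · rw [hk, u_self]
    · rw [u_succ P s N hk]
      calc _ ≤ ∑' l, pe P k l := ENNReal.tsum_le_tsum fun l => mul_le_of_le_one_right' (ih l)
        _ = 1 := pe_sum hP k

lemma U_le {P : S → S → ℝ} (s k : S) (a : ℝ≥0∞) (h : ∀ N, u P s N k ≤ a) :
    ∑' n, g P s n k ≤ a := by
  refine ENNReal.tsum_le_of_sum_range_le fun n => ?_
  refine le_trans ?_ (h n)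
  exact sum_le_sum_of_subset (range_mono (by omega))

lemma U_self (P : S → S → ℝ) (s : S) : ∑' n, g P s n s = 1 := by
  rw [tsum_eq_zero_add' ENNReal.summable]
  simp [g]

lemma U_eq (P : S → S → ℝ) (s : S) {k : S} (hk : k ≠ s) :
    ∑' n, g P s n k = ∑' l, pe P k l * ∑' n, g P s n l := by
  rw [tsum_eq_zero_add' ENNReal.summable]
  simp_rw [← ENNReal.tsum_mul_left]
  rw [ENNReal.tsum_comm]
  simp [g, hk]

/-- If some state hits `s` with probability `< 1`, then `s` is transient. -/
lemma transient_of_U {P : S → S → ℝ} (hP : IsStochastic P) (hirr : MCIrreducible P) (s i : S)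
    (hi : ∑' n, g P s n i < 1) : returnProb P s < 1 := by
  by_contra hcon
  rw [not_lt, returnProb_eq hP] at hcon
  set U : S → ℝ≥0∞ := fun k => ∑' n, g P s n k with hU
  have hsub : ∀ k, U k ≤ ∑' l, pe P k l * U l := by
    intro k
    by_cases hk : k = s
    · subst hk
      simpa [hU, U_self] using hcon
    · exact (U_eq P s hk).le
  have hU1 : ∀ k, U k ≤ 1 := fun k => U_le s k 1 fun N => u_le_one hP s N k
  have hn : ∀ n, 1 ≤ ∑' j, en P n s j * U j := by
    intro n
    induction n with
    | zero => simp [en, hU, U_self]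
    | succ n ih =>
      refine ih.trans ?_
      calc ∑' j, en P n s j * U j ≤ ∑' j, en P n s j * ∑' l, pe P j l * U l :=
            ENNReal.tsum_le_tsum fun j => mul_le_mul_right (hsub j) _
        _ = ∑' l, ∑' j, en P n s j * (pe P j l * U l) := by
            simp_rw [← ENNReal.tsum_mul_left]
            rw [ENNReal.tsum_comm]
        _ = _ := by
            refine tsum_congr fun l => ?_
            simp only [en]
            rw [← ENNReal.tsum_mul_right]
            exact tsum_congr fun j => (mul_assoc _ _ _).symm
  obtain ⟨n, hpos⟩ := hirr s i
  rw [nstep_eq hP] at hpos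
  have hpos' := ENNReal.toReal_pos_iff.1 hpos
  have hlt : ∑' j, en P n s j * U j < ∑' j, en P n s j := by
    refine ENNReal.tsum_lt_tsum (i := i) ?_ (fun j => mul_le_of_le_one_right' (hU1 j)) ?_
    · exact ne_top_of_le_ne_top ENNReal.one_ne_top (le_trans
        (ENNReal.tsum_le_tsum fun j => mul_le_of_le_one_right' (hU1 j)) (en_sum hP n s).le)
    · calc en P n s i * U i < en P n s i * 1 :=
            (ENNReal.mul_lt_mul_iff_right hpos'.1.ne' hpos'.2.ne).2 hi
        _ = _ := mul_one _
  rw [en_sum hP] at hlt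
  exact absurd (hn n) (not_le.2 hlt)

lemma en_jump {P : S → S → ℝ} {f : S → ℝ} {b : ℝ}
    (hjump : ∀ i j, b < |f j - f i| → P i j = 0) (n : ℕ) (i j : S) (h : en P n i j ≠ 0) :
    |f j - f i| ≤ n * b := by
  induction n generalizing j with
  | zero =>
    have : i = j := by
      by_contra hne
      simp [en, hne] at h
    simp [this]
  | succ n ih =>
    simp only [en, ne_eq, ENNReal.tsum_eq_zero, not_forall, mul_eq_zero, not_or] at h
    obtain ⟨k, h1, h2⟩ := h
    have h3 := ih k h1
    have h4 : |f j - f k| ≤ b := by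
      by_contra hlt
      exact h2 (by simp [pe, hjump k j (not_le.1 hlt)])
    push_cast
    calc |f j - f i| ≤ |f j - f k| + |f k - f i| := abs_sub_le _ _ _
      _ ≤ _ := by linarith

lemma u_add {P : S → S → ℝ} {f : S → ℝ} {b : ℝ}
    (hjump : ∀ i j, b < |f j - f i| → P i j = 0) (hb : 0 < b) (s : S) (n N : ℕ) (i : S)
    (hi : f s + n * b < f i) : u P s (N + n) i = ∑' j, en P n i j * u P s N j := by
  induction n generalizing N with
  | zero => simp [en]
  | succ n ih =>
    push_cast at hi
    rw [show N + (n + 1) = (N + 1) + n by ring, ih (N + 1) (by linarith)]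
    have : ∀ j, en P n i j * u P s (N + 1) j = ∑' l, en P n i j * (pe P j l * u P s N l) := by
      intro j
      rw [ENNReal.tsum_mul_left]
      by_cases h0 : en P n i j = 0
      · simp [h0]
      · have h1 := abs_le.1 (en_jump hjump n i j h0)
        rw [u_succ]
        rintro rfl
        linarith [h1.1]
    simp_rw [this]
    rw [ENNReal.tsum_comm]
    refine tsum_congr fun l => ?_
    simp only [en]
    rw [← ENNReal.tsum_mul_right]
    exact tsum_congr fun j => (mul_assoc _ _ _).symm

end TransAux

open TransAux

/-- **Transience criterion via an embedded chain.** Let `{Z_n}` be a time-homogeneous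
irreducible Markov chain on a countable state space `S`, and let `{Z̃_n}` be the embedded
chain determined by a finite partition (`part` surjective) and positive integers `T k`,
with transition matrix `Q i j = nstep P (T (part i)) i j`; assume `{Z̃_n}` is
irreducible. If there exist `f : S → ℝ` and positive reals `ε, c, b` such that, for
`𝒜 = {i : f i > c}`: (i) `𝒜` and its complement are nonempty; (ii)
`E(f(Z̃_{n+1}) − f(Z̃_n) | Z̃_n = i) ≥ ε` for every `i ∈ 𝒜`; (iii) `|f j − f i| > b`
implies `P(Z_1 = j | Z_0 = i) = 0`, then `{Z_n}` is transient. -/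
theorem transience_criterion_embedded {S : Type*} [Countable S] (P : S → S → ℝ)
    (hP : IsStochastic P) (hirr : MCIrreducible P)
    (m : ℕ) (part : S → Fin m) (hpart : Function.Surjective part)
    (T : Fin m → ℕ) (hT : ∀ k, 0 < T k)
    (Q : S → S → ℝ) (hQ : Q = fun i j => nstep P (T (part i)) i j)
    (hQirr : MCIrreducible Q)
    (f : S → ℝ) (ε c b : ℝ) (hε : 0 < ε) (hc : 0 < c) (hb : 0 < b)
    (hA : {i : S | c < f i}.Nonempty) (hAc : {i : S | c < f i}ᶜ.Nonempty)
    (hdrift : ∀ i, c < f i → Summable (fun j => Q i j * (f j - f i)) ∧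
      ε ≤ ∑' j, Q i j * (f j - f i))
    (hjump : ∀ i j, b < |f j - f i| → P i j = 0) :
    MCTransient P := by
  intro s
  have hQe : ∀ i j, Q i j = (en P (T (part i)) i j).toReal := by
    intro i j; rw [hQ]; exact nstep_eq hP _ _ _
  have hQ0 : ∀ i j, 0 ≤ Q i j := fun i j => by rw [hQe]; exact ENNReal.toReal_nonneg
  have hQof : ∀ i j, en P (T (part i)) i j = ENNReal.ofReal (Q i j) := by
    intro i j; rw [hQe, ENNReal.ofReal_toReal (en_ne_top hP _ _ _)]
  have hQsum : ∀ i, HasSum (Q i) 1 := by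
    intro i
    have h1 : Q i = fun j => (en P (T (part i)) i j).toReal := funext (hQe i)
    have h2 := ENNReal.hasSum_toReal (f := fun j => en P (T (part i)) i j)
      (by rw [en_sum hP]; exact ENNReal.one_ne_top)
    rw [← ENNReal.tsum_toReal_eq (fun j => en_ne_top hP _ _ _), en_sum hP] at h2
    rw [h1]
    simpa using h2
  -- uniform bound
  obtain ⟨M, hM⟩ : ∃ M : ℕ, ∀ k, T k ≤ M :=
    ⟨∑ k, T k, fun k => Finset.single_le_sum (f := T) (fun _ _ => Nat.zero_le _) (Finset.mem_univ k)⟩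
  set B : ℝ := M * b + ε with hB
  have hMb : 0 ≤ (M : ℝ) * b := by positivity
  have hBpos : 0 < B := by positivity
  have hTB : ∀ i, (T (part i) : ℝ) * b ≤ B := by
    intro i
    have : (T (part i) : ℝ) ≤ M := by exact_mod_cast hM _
    nlinarith
  have hjB : ∀ i j, Q i j ≠ 0 → |f j - f i| ≤ B := by
    intro i j h
    refine le_trans (en_jump hjump (T (part i)) i j ?_) (hTB i)
    intro h0; apply h; rw [hQe, h0]; simp
  -- f unbounded
  have hstep : ∀ i, c < f i → ∃ j, f i + ε ≤ f j := by
    intro i hi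
    by_contra hcon
    push Not at hcon
    obtain ⟨hs, hd⟩ := hdrift i hi
    have hlt : ∑' j, Q i j * (f j - f i) < ∑' j, Q i j * ε := by
      obtain ⟨j0, hj0⟩ : ∃ j, Q i j ≠ 0 := by
        by_contra hz
        push Not at hz
        have h1 := (hQsum i).tsum_eq
        simp [hz] at h1
      refine Summable.tsum_lt_tsum (i := j0) (fun j => ?_) ?_ hs ((hQsum i).summable.mul_right ε)
      · exact mul_le_mul_of_nonneg_left (by linarith [hcon j]) (hQ0 i j)
      · exact mul_lt_mul_of_pos_left (by linarith [hcon j0]) (lt_of_le_of_ne (hQ0 i j0) hj0.symm)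
    rw [tsum_mul_right, (hQsum i).tsum_eq] at hlt
    linarith
  have hunb : ∀ n : ℕ, ∃ i, c + n * ε < f i := by
    intro n
    induction n with
    | zero => obtain ⟨i, hi⟩ := hA; exact ⟨i, by simpa using hi⟩
    | succ n ih =>
      obtain ⟨i, hi⟩ := ih
      have : 0 ≤ (n : ℝ) * ε := by positivity
      obtain ⟨j, hj⟩ := hstep i (by linarith)
      exact ⟨j, by push_cast; linarith⟩
  set c' : ℝ := max c (f s + B) with hc'
  obtain ⟨i0, hi0⟩ : ∃ i, c' < f i := by
    obtain ⟨n, hn⟩ := exists_nat_gt ((c' - c) / ε)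
    obtain ⟨i, hi⟩ := hunb n
    rw [div_lt_iff₀ hε] at hn
    exact ⟨i, by linarith⟩
  -- Lyapunov function
  set δ : ℝ := ε / B ^ 2 with hδ
  have hδpos : 0 < δ := by positivity
  have hδB : δ * B ≤ 1 := by
    rw [hδ, div_mul_eq_mul_div, div_le_one (by positivity)]
    nlinarith
  have hδB2 : δ ^ 2 * B ^ 2 = δ * ε := by
    rw [hδ]; field_simp
  set h : S → ℝ := fun i => min 1 (Real.exp (-(δ * (f i - c')))) with hh
  have hh0 : ∀ i, 0 ≤ h i := fun i => le_min zero_le_one (Real.exp_pos _).le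
  have hsuper : ∀ i, c' < f i → ∑' j, ENNReal.ofReal (Q i j) * ENNReal.ofReal (h j)
      ≤ ENNReal.ofReal (h i) := by
    intro i hi
    have hci : c < f i := lt_of_le_of_lt (le_max_left _ _) hi
    obtain ⟨hs, hd⟩ := hdrift i hci
    set E := Real.exp (-(δ * (f i - c'))) with hE
    have hEpos : 0 < E := Real.exp_pos _
    have hhi : h i = E := by
      simp only [hh]
      apply min_eq_right
      rw [Real.exp_le_one_iff]
      nlinarith
    have hpt : ∀ j, Q i j * h j ≤
        E * ((1 + δ ^ 2 * B ^ 2) * Q i j - δ * (Q i j * (f j - f i))) := by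
      intro j
      by_cases h0 : Q i j = 0
      · simp [h0]
      have hd := hjB i j h0
      have hx : |-(δ * (f j - f i))| ≤ 1 := by
        rw [abs_neg, abs_mul, abs_of_pos hδpos]
        exact le_trans (mul_le_mul_of_nonneg_left hd hδpos.le) hδB
      have h1 := (abs_le.1 (Real.abs_exp_sub_one_sub_id_le hx)).2
      have h2 : (f j - f i) ^ 2 ≤ B ^ 2 := sq_le_sq' (abs_le.1 hd).1 (abs_le.1 hd).2
      have h3 : Real.exp (-(δ * (f j - f i))) ≤ 1 + δ ^ 2 * B ^ 2 - δ * (f j - f i) := by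
        have : (-(δ * (f j - f i))) ^ 2 ≤ δ ^ 2 * B ^ 2 := by
          rw [neg_sq, mul_pow]
          exact mul_le_mul_of_nonneg_left h2 (sq_nonneg _)
        linarith
      have h4 : h j ≤ E * Real.exp (-(δ * (f j - f i))) := by
        rw [hE, ← Real.exp_add]
        refine le_trans (min_le_right _ _) (le_of_eq ?_)
        congr 1; ring
      calc Q i j * h j ≤ Q i j * (E * (1 + δ ^ 2 * B ^ 2 - δ * (f j - f i))) :=
            mul_le_mul_of_nonneg_left (h4.trans (mul_le_mul_of_nonneg_left h3 hEpos.le)) (hQ0 i j)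
        _ = _ := by ring
    have hS := (((hQsum i).mul_left (1 + δ ^ 2 * B ^ 2)).sub (hs.hasSum.mul_left δ)).mul_left E
    have hSQ : Summable fun j => Q i j * h j :=
      Summable.of_nonneg_of_le (fun j => mul_nonneg (hQ0 i j) (hh0 j)) hpt hS.summable
    have hle : ∑' j, Q i j * h j ≤ E := by
      refine (hSQ.tsum_le_tsum hpt hS.summable).trans ?_
      rw [hS.tsum_eq, hδB2]
      have : (1 + δ * ε) * 1 - δ * ∑' j, Q i j * (f j - f i) ≤ 1 := by nlinarith
      nlinarith
    simp_rw [← ENNReal.ofReal_mul (hQ0 i _)]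
    rw [← ENNReal.ofReal_tsum_of_nonneg (fun j => mul_nonneg (hQ0 i j) (hh0 j)) hSQ, hhi]
    exact ENNReal.ofReal_le_ofReal hle
  have hlow : ∀ i, f i ≤ c' → h i = 1 := by
    intro i hi
    simp only [hh]
    apply min_eq_left
    rw [Real.one_le_exp_iff]
    nlinarith
  have hmain : ∀ N i, u P s N i ≤ ENNReal.ofReal (h i) := by
    intro N
    induction N with
    | zero =>
      intro i
      by_cases his : i = s
      · subst his
        rw [hlow i (le_trans (by linarith) (le_max_right _ _))]
        simpa using u_le_one hP i 0 i
      · simp [u, g, his]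
    | succ N ih =>
      intro i
      rcases le_or_gt (f i) c' with hi | hi
      · rw [hlow i hi]
        simpa using u_le_one hP s (N + 1) i
      · have hi' : f s + B < f i := lt_of_le_of_lt (le_max_right _ _) hi
        calc u P s (N + 1) i ≤ u P s (N + T (part i)) i :=
              u_mono P s (by have := hT (part i); omega) i
          _ = ∑' j, en P (T (part i)) i j * u P s N j :=
              u_add hjump hb s _ N i (by linarith [hTB i])
          _ ≤ ∑' j, ENNReal.ofReal (Q i j) * ENNReal.ofReal (h j) := by
              refine ENNReal.tsum_le_tsum fun j => ?_
              rw [hQof]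
              exact mul_le_mul_right (ih j) _
          _ ≤ _ := hsuper i hi
  refine transient_of_U hP hirr s i0 (lt_of_le_of_lt (U_le s i0 _ fun N => hmain N i0) ?_)
  rw [ENNReal.ofReal_lt_one]
  refine lt_of_le_of_lt (min_le_right _ _) ?_
  rw [Real.exp_lt_one_iff]
  have : 0 < δ * (f i0 - c') := mul_pos hδpos (by linarith)
  linarith
end

section
/- For all real numbers r12 > 0, r23 > 0, r31 > 0 with r12·r23·r31 < 1, there exist positive real numbers u11, u22, u33, u12, u23, u13 such that r12·u22 < u12 < u11/r12, r23·u33 < u23 < u22/r23, r31·u11 < u13 < u33/r31, u11·u22 − u12² > 0, and u11·u22·u33 + 2·u12·u23·u13 − u11·u23² − u22·u13² − u33·u12² > 0 (the last two conditions, together with u11 > 0, make the symmetric 3×3 matrix with diagonal entries u11, u22, u33 and off-diagonal entries u12, u23, u13 positive definite). -/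
/-- Feasibility of the system of linear and quadratic inequalities arising in the proof
of positive recurrence for a spiraling 3-dimensional reflecting random walk: for all
positive drift ratios `r12, r23, r31` with `r12·r23·r31 < 1` there exist positive reals
`u11, u22, u33, u12, u23, u13` satisfying the six linear inequalities together with the
two determinant inequalities making the symmetric matrix with diagonal `u11, u22, u33`
and off-diagonal entries `u12, u23, u13` positive definite. -/
theorem spiral_feasibility (r12 r23 r31 : ℝ) (h12 : 0 < r12) (h23 : 0 < r23)
    (h31 : 0 < r31) (hprod : r12 * r23 * r31 < 1) :
    ∃ u11 u22 u33 u12 u23 u13 : ℝ,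
      0 < u11 ∧ 0 < u22 ∧ 0 < u33 ∧ 0 < u12 ∧ 0 < u23 ∧ 0 < u13 ∧
      r12 * u22 < u12 ∧ u12 < u11 / r12 ∧
      r23 * u33 < u23 ∧ u23 < u22 / r23 ∧
      r31 * u11 < u13 ∧ u13 < u33 / r31 ∧
      0 < u11 * u22 - u12 ^ 2 ∧
      0 < u11 * u22 * u33 + 2 * u12 * u23 * u13 - u11 * u23 ^ 2 - u22 * u13 ^ 2 -
        u33 * u12 ^ 2 := by
  obtain ⟨t, ht, ht3⟩ : ∃ t : ℝ, 0 < t ∧ t ^ 3 = r12 * r23 * r31 := by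
    refine ⟨(r12 * r23 * r31) ^ ((1 : ℝ) / 3), by positivity, ?_⟩
    rw [← Real.rpow_natCast, ← Real.rpow_mul (by positivity)]
    norm_num
  have ht1 : t < 1 := by
    by_contra h
    have := one_le_pow₀ (n := 3) (not_lt.mp h)
    linarith
  obtain ⟨b, c, hb, hc, e1, e2, e3⟩ : ∃ b c : ℝ, 0 < b ∧ 0 < c ∧
      r12 = t / b ∧ r23 = t * b / c ∧ r31 = t * c := by
    refine ⟨t / r12, t ^ 2 / (r12 * r23), by positivity, by positivity, ?_, ?_, ?_⟩
    · field_simp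
    · field_simp
    · field_simp
      linarith
  obtain ⟨x, hx, hx1⟩ := exists_between ht1
  have hx0 : 0 < x := ht.trans hx
  have htx : x * t < 1 := by nlinarith
  subst e1 e2 e3
  refine ⟨1, b ^ 2, c ^ 2, b * x, b * c * x, c * x, by positivity, by positivity,
    by positivity, by positivity, by positivity, by positivity, ?_, ?_, ?_, ?_, ?_, ?_, ?_, ?_⟩
  · have : t / b * b ^ 2 = b * t := by field_simp
    rw [this]; gcongr
  · rw [lt_div_iff₀ (by positivity)]
    have : b * x * (t / b) = x * t := by field_simp
    rw [this]; exact htx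
  · have : t * b / c * c ^ 2 = b * c * t := by field_simp
    rw [this]; gcongr
  · rw [lt_div_iff₀ (by positivity)]
    have : b * c * x * (t * b / c) = b ^ 2 * (x * t) := by field_simp
    rw [this]
    exact mul_lt_of_lt_one_right (by positivity) htx
  · have : t * c * 1 = c * t := by ring
    rw [this]; gcongr
  · rw [lt_div_iff₀ (by positivity)]
    have : c * x * (t * c) = c ^ 2 * (x * t) := by ring
    rw [this]
    exact mul_lt_of_lt_one_right (by positivity) htx
  · have : 1 * b ^ 2 - (b * x) ^ 2 = b ^ 2 * ((1 - x) * (1 + x)) := by ring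
    rw [this]
    have : 0 < 1 - x := by linarith
    positivity
  · have h : 0 < 1 - x := by linarith
    have : 0 < b ^ 2 * c ^ 2 * ((1 - x) ^ 2 * (1 + 2 * x)) := by positivity
    linarith
end
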